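/- arXiv:0706.0150 — 2 statements merged into one kernel-verified Lean document; each statement's English description precedes it below -/
import Mathlib

section
/- Nonexistence under a positive supersolution of the linear operator (Euclidean case): Let a, b : ℝ^m → ℝ be continuous (m ≥ 2) with b nonnegative and not identically zero, let H ≥ 1, and suppose there exists a positive C² function φ on ℝ^m satisfying Δφ + H a(x) φ ≤ 0 on ℝ^m. Then for any σ ∈ ℝ there is no positive C² function u on ℝ^m satisfying Δu + a(x)u − b(x)u^σ ≥ 0 on ℝ^m for which, for some β with 0 ≤ β ≤ H − 1, the function r ↦ ( ∫_{∂B_r} u^{2(β+1)} dS )^{−1} fails to be integrable at +∞. -/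
open MeasureTheory Metric Set Filter

/-- The Euclidean Laplacian: the sum of the unmixed second partial derivatives. -/
noncomputable def lap {m : ℕ} (u : EuclideanSpace ℝ (Fin m) → ℝ) (x : EuclideanSpace ℝ (Fin m)) : ℝ :=
  ∑ i : Fin m, fderiv ℝ (fun y => fderiv ℝ u y (EuclideanSpace.single i 1)) x (EuclideanSpace.single i 1)

open scoped Pointwise ENNReal NNReal

lemma aux_tube {m : ℕ} (hm : 2 ≤ m) (x : EuclideanSpace ℝ (Fin m)) (hx : ‖x‖ = 1) (δ : ℝ)
    (hδ : 0 < δ) (hδ1 : δ ≤ 1) :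
    volume (Ioo (0:ℝ) 1 • closedBall x δ) ≤
      ENNReal.ofReal (δ ^ (m - 1)) * (2 ^ (m + 1) *
        volume (ball (0 : EuclideanSpace ℝ (Fin m)) 1)) := by
  set N := ⌈1 / δ⌉₊ with hN
  have hNle : (N : ℝ) ≤ 2 / δ := by
    have h1 := (Nat.ceil_lt_add_one (by positivity : (0:ℝ) ≤ 1 / δ)).le
    have h2 : (1:ℝ) ≤ 1 / δ := by rw [le_div_iff₀ hδ]; linarith
    have h3 : 2 / δ = 1 / δ + 1 / δ := by ring
    rw [h3]; linarith
  have hsub : Ioo (0:ℝ) 1 • closedBall x δ ⊆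
      ⋃ k ∈ Finset.range N, closedBall (((k : ℝ) * δ) • x) (2 * δ) := by
    rintro _ ⟨t, ht, y, hy, rfl⟩
    have hk1 := Nat.floor_le (by have := ht.1; positivity : (0:ℝ) ≤ t / δ)
    have hk2 := Nat.lt_floor_add_one (t / δ)
    have hk3 : t / δ < 1 / δ := by gcongr; exact ht.2
    have hk4 := Nat.le_ceil (1 / δ)
    refine mem_iUnion₂.2 ⟨⌊t / δ⌋₊, ?_, ?_⟩
    · rw [Finset.mem_range]
      have : ((⌊t / δ⌋₊ : ℕ) : ℝ) < (N : ℝ) := by linarith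
      exact_mod_cast this
    · rw [mem_closedBall, dist_eq_norm] at *
      have e : t • y - ((⌊t / δ⌋₊ : ℝ) * δ) • x = t • (y - x) + (t - (⌊t / δ⌋₊ : ℝ) * δ) • x := by
        module
      simp only
      rw [e]
      refine (norm_add_le _ _).trans ?_
      rw [norm_smul, norm_smul, hx, Real.norm_eq_abs, Real.norm_eq_abs, abs_of_pos ht.1]
      rw [le_div_iff₀ hδ] at hk1
      rw [div_lt_iff₀ hδ] at hk2
      rw [abs_of_nonneg (by linarith)]
      have := mul_le_mul ht.2.le hy (norm_nonneg _) zero_le_one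
      linarith
  refine (measure_mono hsub).trans ((measure_biUnion_finset_le _ _).trans ?_)
  have : ∀ k ∈ Finset.range N, volume (closedBall (((k : ℝ) * δ) • x) (2 * δ)) =
      ENNReal.ofReal ((2 * δ) ^ m) * volume (ball (0 : EuclideanSpace ℝ (Fin m)) 1) := by
    intro k _
    rw [Measure.addHaar_closedBall _ _ (by positivity)]; simp
  rw [Finset.sum_congr rfl this, Finset.sum_const, Finset.card_range, nsmul_eq_mul, ← mul_assoc,
    ← mul_assoc]
  refine mul_le_mul' ?_ le_rfl
  have h2 : (2:ℝ≥0∞) ^ (m+1) = ENNReal.ofReal (2 ^ (m+1)) := by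
    rw [ENNReal.ofReal_pow (by norm_num)]; simp
  rw [h2, ← ENNReal.ofReal_mul (by positivity), ← ENNReal.ofReal_natCast,
    ← ENNReal.ofReal_mul (by positivity)]
  apply ENNReal.ofReal_le_ofReal
  obtain ⟨n, rfl⟩ : ∃ n, m = n + 1 := ⟨m - 1, by omega⟩
  calc (N : ℝ) * (2 * δ) ^ (n + 1) ≤ 2 / δ * (2 * δ) ^ (n + 1) := by gcongr
    _ = _ := by simp only [Nat.add_sub_cancel]; field_simp; ring

lemma aux_toSphere_le {m : ℕ} (hm : 2 ≤ m) : ∃ C : ℝ≥0∞, C ≠ ∞ ∧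
    (volume : Measure (EuclideanSpace ℝ (Fin m))).toSphere ≤
      C • (μH[(m:ℝ) - 1] : Measure (sphere (0 : EuclideanSpace ℝ (Fin m)) 1)) := by
  set V := volume (ball (0 : EuclideanSpace ℝ (Fin m)) 1) with hV
  set C : ℝ≥0∞ := m * (2 ^ (m + 1) * V) with hC
  have hVtop : V ≠ ∞ := measure_ball_lt_top.ne
  have hV0 : V ≠ 0 := (measure_ball_pos _ _ one_pos).ne'
  have hCtop : C ≠ ∞ := by
    rw [hC]; exact ENNReal.mul_ne_top (by simp) (ENNReal.mul_ne_top (by simp) hVtop)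
  have hC0 : C ≠ 0 := by
    rw [hC]; refine mul_ne_zero ?_ (mul_ne_zero (by simp) hV0)
    simp; omega
  refine ⟨C, hCtop, ?_⟩
  -- ball estimate
  have hball : ∀ (x : sphere (0 : EuclideanSpace ℝ (Fin m)) 1) (δ : ℝ), 0 < δ → δ ≤ 1 →
      (volume : Measure (EuclideanSpace ℝ (Fin m))).toSphere (closedBall x δ) ≤
        C * ENNReal.ofReal (δ ^ (m - 1)) := by
    intro x δ h0 h1
    rw [Measure.toSphere_apply' _ isClosed_closedBall.measurableSet, hC, mul_assoc]
    simp only [finrank_euclideanSpace, Fintype.card_fin]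
    gcongr
    rw [mul_comm]
    refine (measure_mono ?_).trans (aux_tube hm x.1 (by simp) δ h0 h1)
    apply Set.smul_subset_smul_left
    rintro _ ⟨y, hy, rfl⟩
    simpa [mem_closedBall, Subtype.dist_eq] using hy
  have key : C⁻¹ • (volume : Measure (EuclideanSpace ℝ (Fin m))).toSphere ≤ μH[(m:ℝ) - 1] := by
    refine Measure.le_hausdorffMeasure _ _ 1 one_pos ?_
    intro s hs
    rw [Measure.smul_apply, smul_eq_mul, ENNReal.inv_mul_le_iff hC0 hCtop]
    rcases s.eq_empty_or_nonempty with rfl | ⟨x, hx⟩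
    · simp
    have hdne : ediam s ≠ ∞ := ne_top_of_le_ne_top ENNReal.one_ne_top hs
    have hsub : ∀ δ : ℝ, 0 < δ → ediam s ≤ ENNReal.ofReal δ → s ⊆ closedBall x δ := by
      intro δ h0 h y hy
      have := (edist_le_ediam_of_mem hy hx).trans h
      rw [edist_dist] at this
      exact (ENNReal.ofReal_le_ofReal_iff h0.le).1 this
    rcases eq_or_ne (ediam s) 0 with h0 | h0
    · have hlim : Tendsto (fun δ : ℝ => C * ENNReal.ofReal (δ ^ (m - 1))) (nhdsWithin 0 (Ioi 0))
          (nhds 0) := by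
        have h1 : Tendsto (fun δ : ℝ => C * ENNReal.ofReal (δ ^ (m - 1))) (nhds 0)
          (nhds (C * ENNReal.ofReal ((0:ℝ) ^ (m - 1)))) := by
          apply ENNReal.Tendsto.const_mul _ (Or.inr hCtop)
          exact (ENNReal.continuous_ofReal.comp (continuous_pow _)).tendsto _
        rw [zero_pow (by omega)] at h1
        simp only [ENNReal.ofReal_zero, mul_zero] at h1
        exact h1.mono_left nhdsWithin_le_nhds
      have : (volume : Measure (EuclideanSpace ℝ (Fin m))).toSphere s ≤ 0 := by
        refine ge_of_tendsto hlim ?_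
        filter_upwards [Ioc_mem_nhdsGT (zero_lt_one' ℝ)] with δ hδ
        exact (measure_mono (hsub δ hδ.1 (by simp [h0]))).trans (hball x δ hδ.1 hδ.2)
      exact this.trans (zero_le)
    · have hpos : 0 < (ediam s).toReal := ENNReal.toReal_pos h0 hdne
      have h1 : (ediam s).toReal ≤ 1 := by
        simpa using ENNReal.toReal_mono ENNReal.one_ne_top hs
      refine (measure_mono (hsub _ hpos (by rw [ENNReal.ofReal_toReal hdne]))).trans
        ((hball x _ hpos h1).trans ?_)
      gcongr
      have e : ((m:ℝ) - 1) = ((m - 1 : ℕ) : ℝ) := by rw [Nat.cast_sub (by omega)]; simp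
      rw [e, ENNReal.rpow_natCast, ENNReal.ofReal_pow hpos.le, ENNReal.ofReal_toReal hdne]
  rw [Measure.le_iff]
  intro s hs
  have := key s
  rw [Measure.smul_apply, smul_eq_mul, ENNReal.inv_mul_le_iff hC0 hCtop] at this
  simpa using this

lemma aux_polar {m : ℕ} (hm : 2 ≤ m) : ∃ C : ℝ≥0∞, C ≠ ∞ ∧
    ∀ (F : EuclideanSpace ℝ (Fin m) → ℝ≥0∞) (g : ℝ → ℝ≥0∞), Measurable F → Measurable g →
    ∫⁻ x, F x * g ‖x‖ ≤ C * ∫⁻ r in Ioi (0:ℝ), g r * (ENNReal.ofReal (r ^ (m - 1)) *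
      ∫⁻ ω : sphere (0 : EuclideanSpace ℝ (Fin m)) 1, F (r • ω.1) ∂μH[(m:ℝ) - 1]) := by
  obtain ⟨C, hC, hle⟩ := aux_toSphere_le hm
  refine ⟨C, hC, fun F g hF hg => ?_⟩
  have : Nonempty (Fin m) := ⟨⟨0, by omega⟩⟩
  have hG : Measurable (fun p : sphere (0 : EuclideanSpace ℝ (Fin m)) 1 × Ioi (0:ℝ) => F (p.2.1 • p.1.1) * g p.2.1) := by
    refine (hF.comp ?_).mul (hg.comp ?_)
    · fun_prop
    · fun_prop
  have e1 : ∫⁻ x, F x * g ‖x‖ = ∫⁻ x : ({(0 : EuclideanSpace ℝ (Fin m))}ᶜ : Set (EuclideanSpace ℝ (Fin m))), F x.1 * g ‖x.1‖ ∂((volume : Measure (EuclideanSpace ℝ (Fin m))).comap Subtype.val) := by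
    rw [lintegral_subtype_comap (measurableSet_singleton _).compl (fun x => F x * g ‖x‖),
      restrict_compl_singleton]
  have e2 : ∫⁻ x : ({(0 : EuclideanSpace ℝ (Fin m))}ᶜ : Set (EuclideanSpace ℝ (Fin m))), F x.1 * g ‖x.1‖ ∂((volume : Measure (EuclideanSpace ℝ (Fin m))).comap Subtype.val) =
      ∫⁻ p, F (p.2.1 • p.1.1) * g p.2.1
        ∂((volume : Measure (EuclideanSpace ℝ (Fin m))).toSphere.prod (Measure.volumeIoiPow (Module.finrank ℝ (EuclideanSpace ℝ (Fin m)) - 1))) := by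
    rw [← (Measure.measurePreserving_homeomorphUnitSphereProd
      (volume : Measure (EuclideanSpace ℝ (Fin m)))).lintegral_comp hG]
    refine lintegral_congr fun x => ?_
    have hx : ‖x.1‖ ≠ 0 := norm_ne_zero_iff.2 x.2
    simp [homeomorphUnitSphereProd, smul_smul, hx]
  rw [e1, e2, lintegral_prod_symm _ hG.aemeasurable]
  have hfin : Module.finrank ℝ (EuclideanSpace ℝ (Fin m)) - 1 = m - 1 := by simp
  rw [hfin, Measure.volumeIoiPow]
  have e3 : ∀ r : Ioi (0:ℝ), ∫⁻ ω : sphere (0 : EuclideanSpace ℝ (Fin m)) 1, F (r.1 • ω.1) * g r.1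
      ∂(volume : Measure (EuclideanSpace ℝ (Fin m))).toSphere ≤
      C * (g r.1 * ∫⁻ ω : sphere (0 : EuclideanSpace ℝ (Fin m)) 1, F (r.1 • ω.1) ∂μH[(m:ℝ) - 1]) := by
    intro r
    have hFr : Measurable fun ω : sphere (0 : EuclideanSpace ℝ (Fin m)) 1 => F (r.1 • ω.1) := hF.comp (by fun_prop)
    refine (lintegral_mono' hle le_rfl).trans_eq ?_
    rw [lintegral_smul_measure, lintegral_mul_const _ hFr, smul_eq_mul, mul_comm (g r.1)]
  refine (lintegral_mono e3).trans ?_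
  rw [lintegral_const_mul' _ _ hC]
  gcongr
  rw [lintegral_withDensity_eq_lintegral_mul_non_measurable₀ _ (by fun_prop)]
  rotate_left
  · simp
  rw [← lintegral_subtype_comap measurableSet_Ioi]
  refine lintegral_mono fun r => ?_
  simp only [Pi.mul_apply]
  rw [mul_left_comm]

lemma aux_sphere {m : ℕ} (hm : 2 ≤ m) (r : ℝ) (hr : 0 < r) (F : EuclideanSpace ℝ (Fin m) → ℝ) :
    ∫ x in sphere (0 : EuclideanSpace ℝ (Fin m)) r, F x ∂μH[(m:ℝ) - 1] =
    r ^ (m - 1) * ∫ ω : sphere (0 : EuclideanSpace ℝ (Fin m)) 1, F (r • ω.1) ∂μH[(m:ℝ) - 1] := by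
  have hd : (0:ℝ) ≤ (m:ℝ) - 1 := by
    have : (2:ℝ) ≤ m := by exact_mod_cast hm
    linarith
  have hemb : MeasurableEmbedding (fun ω : sphere (0 : EuclideanSpace ℝ (Fin m)) 1 => r • ω.1) :=
    (measurableEmbedding_const_smul₀ hr.ne').comp
      (MeasurableEmbedding.subtype_coe isClosed_sphere.measurableSet)
  have key : (μH[(m:ℝ) - 1] : Measure (EuclideanSpace ℝ (Fin m))).restrict (sphere 0 r) =
      (ENNReal.ofReal (r ^ (m - 1))) •
        Measure.map (fun ω : sphere (0 : EuclideanSpace ℝ (Fin m)) 1 => r • ω.1) μH[(m:ℝ) - 1] := by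
    ext s hs
    rw [Measure.restrict_apply hs, Measure.smul_apply, hemb.map_apply,
      ← (isometry_subtype_coe (s := sphere (0 : EuclideanSpace ℝ (Fin m)) 1)).hausdorffMeasure_image (Or.inl hd)]
    have himg : s ∩ sphere (0 : EuclideanSpace ℝ (Fin m)) r =
        r • (((↑) : sphere (0 : EuclideanSpace ℝ (Fin m)) 1 → (EuclideanSpace ℝ (Fin m))) '' ((fun ω : sphere (0 : EuclideanSpace ℝ (Fin m)) 1 => r • ω.1) ⁻¹' s)) := by
      ext x
      constructor
      · rintro ⟨hx, hx'⟩
        have hxn : ‖x‖ = r := by simpa using hx'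
        have h1 : r • (r⁻¹ • x) = x := by rw [smul_smul, mul_inv_cancel₀ hr.ne', one_smul]
        refine ⟨r⁻¹ • x, ⟨⟨r⁻¹ • x, ?_⟩, ?_, rfl⟩, h1⟩
        · simp [norm_smul, hxn, abs_of_pos hr, hr.ne']
        · simpa [h1] using hx
      · rintro ⟨_, ⟨ω, hω, rfl⟩, rfl⟩
        refine ⟨hω, ?_⟩
        simp [norm_smul, abs_of_pos hr]
    rw [himg, Measure.hausdorffMeasure_smul₀ hd hr.ne']
    rw [ENNReal.smul_def]
    congr 1
    have e : ((m:ℝ) - 1) = ((m - 1 : ℕ) : ℝ) := by rw [Nat.cast_sub (by omega)]; simp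
    rw [e, NNReal.rpow_natCast, ENNReal.ofReal_pow hr.le, ENNReal.coe_pow]
    congr 1
    exact (Real.enorm_eq_ofReal hr.le)
  rw [key, integral_smul_measure, hemb.integral_map, ENNReal.toReal_ofReal (by positivity)]
  simp

lemma aux_ibp {m : ℕ} (X : Fin m → EuclideanSpace ℝ (Fin m) → ℝ) (hX : ∀ i, ContDiff ℝ 1 (X i))
    (η : EuclideanSpace ℝ (Fin m) → ℝ) (hη : ContDiff ℝ 1 η) (hc : HasCompactSupport η) :
    Integrable (fun x => ∑ i, (2 * η x * fderiv ℝ η x (EuclideanSpace.single i 1) * X i x +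
      η x ^ 2 * fderiv ℝ (X i) x (EuclideanSpace.single i 1))) ∧
    ∫ x, ∑ i, (2 * η x * fderiv ℝ η x (EuclideanSpace.single i 1) * X i x +
      η x ^ 2 * fderiv ℝ (X i) x (EuclideanSpace.single i 1)) = 0 := by
  have hdη : ∀ v, Continuous fun x => fderiv ℝ η x v := fun v =>
    (hη.continuous_fderiv one_ne_zero).clm_apply continuous_const
  have hdX : ∀ i v, Continuous fun x => fderiv ℝ (X i) x v := fun i v =>
    ((hX i).continuous_fderiv one_ne_zero).clm_apply continuous_const
  have hXc : ∀ i, Continuous (X i) := fun i => (hX i).continuous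
  have hηc := hη.continuous
  have hcs : ∀ G : EuclideanSpace ℝ (Fin m) → ℝ, Continuous G → (∀ x, η x = 0 → G x = 0) →
      Integrable G := by
    intro G hG h
    refine hG.integrable_of_hasCompactSupport (hc.mono ?_)
    intro x hx hx'
    exact hx (h x hx')
  have i1 : ∀ i, Integrable (fun x => 2 * η x * fderiv ℝ η x (EuclideanSpace.single i 1) * X i x) :=
    fun i => hcs _ (by have := hdη (EuclideanSpace.single i 1); have := hXc i; fun_prop)
      (fun x hx => by simp [hx])
  have i2 : ∀ i, Integrable (fun x => η x ^ 2 * fderiv ℝ (X i) x (EuclideanSpace.single i 1)) :=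
    fun i => hcs _ (by have := hdX i (EuclideanSpace.single i 1); fun_prop)
      (fun x hx => by simp [hx])
  have i3 : ∀ i, Integrable (fun x => η x ^ 2 * X i x) :=
    fun i => hcs _ (by have := hXc i; fun_prop) (fun x hx => by simp [hx])
  refine ⟨integrable_finsetSum _ fun i _ => (i1 i).add (i2 i), ?_⟩
  rw [integral_finsetSum]
  rotate_left
  · exact fun i _ => (i1 i).add (i2 i)
  refine Finset.sum_eq_zero fun i _ => ?_
  have hfd : ∀ x, fderiv ℝ (fun y => η y ^ 2) x (EuclideanSpace.single i 1) =
      2 * η x * fderiv ℝ η x (EuclideanSpace.single i 1) := by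
    intro x
    rw [fderiv_fun_pow _ (hη.differentiable one_ne_zero x)]
    simp
  rw [integral_add (i1 i) (i2 i)]
  have := integral_mul_fderiv_eq_neg_fderiv_mul_of_integrable (μ := volume)
    (f := fun y => η y ^ 2) (g := X i) (v := EuclideanSpace.single i 1)
    (by simpa only [hfd] using i1 i) (i2 i) (i3 i)
    (fun x _ => (hη.differentiable one_ne_zero x).pow 2)
    (fun x _ => (hX i).differentiable one_ne_zero x)
  rw [this]
  simp only [hfd]
  ring

lemma aux_X_deriv {m : ℕ} (u φ : EuclideanSpace ℝ (Fin m) → ℝ) (hu : ContDiff ℝ 2 u)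
    (hφ : ContDiff ℝ 2 φ) (hu0 : ∀ x, 0 < u x) (hφ0 : ∀ x, 0 < φ x) (H α : ℝ) (hH : 1 ≤ H)
    (e : EuclideanSpace ℝ (Fin m)) :
    ContDiff ℝ 1 (fun y => u y ^ (2 * α) * (fderiv ℝ u y e / u y - fderiv ℝ φ y e / (H * φ y))) ∧
    ∀ x, fderiv ℝ (fun y => u y ^ (2 * α) *
      (fderiv ℝ u y e / u y - fderiv ℝ φ y e / (H * φ y))) x e =
      u x ^ (2 * α) * (2 * α * (fderiv ℝ u x e / u x) *
        (fderiv ℝ u x e / u x - fderiv ℝ φ x e / (H * φ x)) +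
      (fderiv ℝ (fun y => fderiv ℝ u y e) x e / u x - (fderiv ℝ u x e / u x) ^ 2
        - fderiv ℝ (fun y => fderiv ℝ φ y e) x e / (H * φ x)
        + H * (fderiv ℝ φ x e / (H * φ x)) ^ 2)) := by
  have hH0 : H ≠ 0 := by linarith
  have hdu : ContDiff ℝ 1 fun y => fderiv ℝ u y e :=
    (hu.fderiv_right (m := 1) (by norm_num)).clm_apply contDiff_const
  have hdφ : ContDiff ℝ 1 fun y => fderiv ℝ φ y e :=
    (hφ.fderiv_right (m := 1) (by norm_num)).clm_apply contDiff_const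
  have hu1 : ContDiff ℝ 1 u := hu.of_le (by norm_num)
  have hφ1 : ContDiff ℝ 1 φ := hφ.of_le (by norm_num)
  have hC : ContDiff ℝ 1 (fun y => u y ^ (2 * α) *
      (fderiv ℝ u y e / u y - fderiv ℝ φ y e / (H * φ y))) := by
    refine (hu1.rpow_const_of_ne fun x => (hu0 x).ne').mul
      ((hdu.div hu1 fun x => (hu0 x).ne').sub (hdφ.div (contDiff_const.mul hφ1) fun x => ?_))
    exact mul_ne_zero hH0 (hφ0 x).ne'
  refine ⟨hC, fun x => ?_⟩
  have line : ∀ f : EuclideanSpace ℝ (Fin m) → ℝ, ContDiff ℝ 1 f →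
      HasDerivAt (fun t : ℝ => f (x + t • e)) (fderiv ℝ f x e) 0 := by
    intro f hf
    exact ((hf.differentiable one_ne_zero x).hasFDerivAt.hasLineDerivAt e)
  have h1 := line _ hC
  have hux : u (x + (0:ℝ) • e) ≠ 0 := (hu0 _).ne'
  have hφx : H * φ (x + (0:ℝ) • e) ≠ 0 := mul_ne_zero hH0 (hφ0 _).ne'
  have h2 := ((line u hu1).rpow_const (p := 2 * α) (Or.inl hux)).mul
    (((line _ hdu).div (line u hu1) hux).sub
      ((line _ hdφ).div ((line φ hφ1).const_mul H) hφx))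
  have h3 := h1.unique h2
  rw [h3]
  simp only [zero_smul, add_zero, Pi.div_apply, Pi.sub_apply]
  have hu' := (hu0 x).ne'
  have hφ' := (hφ0 x).ne'
  rw [Real.rpow_sub_one hu']
  field_simp
  ring

lemma aux_pointwise {m : ℕ} (a b : EuclideanSpace ℝ (Fin m) → ℝ)
    (u φ η : EuclideanSpace ℝ (Fin m) → ℝ) (hu : ContDiff ℝ 2 u)
    (hφ : ContDiff ℝ 2 φ) (hu0 : ∀ x, 0 < u x) (hφ0 : ∀ x, 0 < φ x) (H α σ : ℝ) (hH : 1 ≤ H)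
    (hα : 1 ≤ α) (hαH : α ≤ H)
    (hφs : ∀ x, lap φ x + H * a x * φ x ≤ 0)
    (hus : ∀ x, 0 ≤ lap u x + a x * u x - b x * u x ^ σ) (x : EuclideanSpace ℝ (Fin m)) :
    η x ^ 2 * (u x ^ (2 * α) * (b x * u x ^ σ / u x)) -
      u x ^ (2 * α) * ∑ i, (fderiv ℝ η x (EuclideanSpace.single i 1)) ^ 2 ≤
    ∑ i : Fin m, (2 * η x * fderiv ℝ η x (EuclideanSpace.single i 1) *
      (u x ^ (2 * α) * (fderiv ℝ u x (EuclideanSpace.single i 1) / u x -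
        fderiv ℝ φ x (EuclideanSpace.single i 1) / (H * φ x))) +
      η x ^ 2 * fderiv ℝ (fun y => u y ^ (2 * α) *
        (fderiv ℝ u y (EuclideanSpace.single i 1) / u y -
          fderiv ℝ φ y (EuclideanSpace.single i 1) / (H * φ y))) x (EuclideanSpace.single i 1)) := by
  have hux := hu0 x
  have hφx := hφ0 x
  have hW : 0 < u x ^ (2 * α) := Real.rpow_pos_of_pos hux _
  have hlow : b x * u x ^ σ / u x ≤ lap u x / u x - lap φ x / (H * φ x) := by
    have h1 : b x * u x ^ σ / u x - a x ≤ lap u x / u x := by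
      rw [le_div_iff₀ hux, sub_mul, div_mul_cancel₀ _ hux.ne']
      linarith [hus x]
    have h2 : lap φ x / (H * φ x) ≤ - a x := by
      rw [div_le_iff₀ (by positivity)]
      linarith [hφs x]
    linarith
  have hstep : ∀ i : Fin m,
      u x ^ (2 * α) * (η x ^ 2 * (fderiv ℝ (fun y => fderiv ℝ u y (EuclideanSpace.single i 1)) x
          (EuclideanSpace.single i 1) / u x -
        fderiv ℝ (fun y => fderiv ℝ φ y (EuclideanSpace.single i 1)) x
          (EuclideanSpace.single i 1) / (H * φ x)) -
        (fderiv ℝ η x (EuclideanSpace.single i 1)) ^ 2) ≤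
      (2 * η x * fderiv ℝ η x (EuclideanSpace.single i 1) *
      (u x ^ (2 * α) * (fderiv ℝ u x (EuclideanSpace.single i 1) / u x -
        fderiv ℝ φ x (EuclideanSpace.single i 1) / (H * φ x))) +
      η x ^ 2 * fderiv ℝ (fun y => u y ^ (2 * α) *
        (fderiv ℝ u y (EuclideanSpace.single i 1) / u y -
          fderiv ℝ φ y (EuclideanSpace.single i 1) / (H * φ y))) x
            (EuclideanSpace.single i 1)) := by
    intro i
    rw [(aux_X_deriv u φ hu hφ hu0 hφ0 H α hH (EuclideanSpace.single i 1)).2 x]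
    generalize fderiv ℝ u x (EuclideanSpace.single i 1) / u x = p
    generalize fderiv ℝ φ x (EuclideanSpace.single i 1) / (H * φ x) = q
    generalize fderiv ℝ η x (EuclideanSpace.single i 1) = n
    generalize fderiv ℝ (fun y => fderiv ℝ u y (EuclideanSpace.single i 1)) x
          (EuclideanSpace.single i 1) / u x = U
    generalize fderiv ℝ (fun y => fderiv ℝ φ y (EuclideanSpace.single i 1)) x
          (EuclideanSpace.single i 1) / (H * φ x) = P
    generalize u x ^ (2 * α) = W at hW
    generalize η x = h
    have k1 : 0 ≤ (n + h * (p - q)) ^ 2 := sq_nonneg _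
    have k2 : 0 ≤ h ^ 2 * ((α - 1) * p ^ 2 + (H - α) * q ^ 2 + (α - 1) * (p - q) ^ 2) := by
      have := sub_nonneg.2 hα
      have := sub_nonneg.2 hαH
      positivity
    have k3 := mul_nonneg hW.le (add_nonneg k1 k2)
    linarith
  refine le_trans ?_ (Finset.sum_le_sum fun i _ => hstep i)
  rw [← Finset.mul_sum, Finset.sum_sub_distrib, ← Finset.mul_sum, Finset.sum_sub_distrib,
    ← Finset.sum_div, ← Finset.sum_div]
  have k := mul_le_mul_of_nonneg_left hlow (mul_nonneg hW.le (sq_nonneg (η x)))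
  simp only [lap] at k
  linarith

/-- Energy inequality with a cutoff function. -/
lemma aux_energy {m : ℕ} (a b : EuclideanSpace ℝ (Fin m) → ℝ) (hb : Continuous b)
    (u φ η : EuclideanSpace ℝ (Fin m) → ℝ) (hu : ContDiff ℝ 2 u)
    (hφ : ContDiff ℝ 2 φ) (hu0 : ∀ x, 0 < u x) (hφ0 : ∀ x, 0 < φ x) (H α σ : ℝ) (hH : 1 ≤ H)
    (hα : 1 ≤ α) (hαH : α ≤ H)
    (hφs : ∀ x, lap φ x + H * a x * φ x ≤ 0)
    (hus : ∀ x, 0 ≤ lap u x + a x * u x - b x * u x ^ σ)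
    (hη : ContDiff ℝ 1 η) (hc : HasCompactSupport η) :
    ∫ x, η x ^ 2 * (u x ^ (2 * α) * (b x * u x ^ σ / u x)) ≤
      ∫ x, u x ^ (2 * α) * ((m : ℝ) * ‖fderiv ℝ η x‖ ^ 2) := by
  have hηc := hη.continuous
  have huc := hu.continuous
  have hup : ∀ p : ℝ, Continuous fun x => u x ^ p := fun p =>
    huc.rpow_const fun x => Or.inl (hu0 x).ne'
  have hdη := hη.continuous_fderiv one_ne_zero
  have J1 : Integrable (fun x => η x ^ 2 * (u x ^ (2 * α) * (b x * u x ^ σ / u x))) := by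
    refine Continuous.integrable_of_hasCompactSupport ?_ (hc.mono ?_)
    · exact (hηc.pow 2).mul ((hup _).mul ((hb.mul (hup _)).div huc fun x => (hu0 x).ne'))
    · intro x hx hx'
      exact hx (by simp [hx'])
  have J2 : Integrable (fun x => u x ^ (2 * α) * ((m : ℝ) * ‖fderiv ℝ η x‖ ^ 2)) := by
    refine Continuous.integrable_of_hasCompactSupport ?_ ((hc.fderiv (𝕜 := ℝ)).mono ?_)
    · exact (hup _).mul (continuous_const.mul (hdη.norm.pow 2))
    · intro x hx hx'
      exact hx (by simp [hx'])
  obtain ⟨I1, I2⟩ := aux_ibp (fun i y => u y ^ (2 * α) *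
        (fderiv ℝ u y (EuclideanSpace.single i 1) / u y -
          fderiv ℝ φ y (EuclideanSpace.single i 1) / (H * φ y)))
    (fun i => (aux_X_deriv u φ hu hφ hu0 hφ0 H α hH (EuclideanSpace.single i 1)).1) η hη hc
  rw [← sub_nonpos, ← integral_sub J1 J2, ← I2]
  refine integral_mono (J1.sub J2) I1 fun x => ?_
  refine le_trans ?_ (aux_pointwise a b u φ η hu hφ hu0 hφ0 H α σ hH hα hαH hφs hus x)
  have hW : 0 < u x ^ (2 * α) := Real.rpow_pos_of_pos (hu0 x) _
  simp only
  gcongr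
  calc ∑ i : Fin m, (fderiv ℝ η x (EuclideanSpace.single i 1)) ^ 2
      ≤ ∑ i : Fin m, ‖fderiv ℝ η x‖ ^ 2 := by
        refine Finset.sum_le_sum fun i _ => ?_
        rw [← sq_abs]
        gcongr
        have := (fderiv ℝ η x).le_opNorm (EuclideanSpace.single i 1)
        simpa using this
    _ = _ := by simp

lemma aux_cutoff : ∃ K : ℝ, 0 < K ∧ ∀ (m : ℕ) (A : ℝ → ℝ) (r₀ R : ℝ), Continuous A → (∀ r, 0 < A r) →
    0 < r₀ → r₀ < R → ∃ η : EuclideanSpace ℝ (Fin m) → ℝ, ContDiff ℝ 1 η ∧ HasCompactSupport η ∧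
      (∀ x, ‖x‖ ≤ r₀ → η x = 1) ∧
      ∀ x, ‖fderiv ℝ η x‖ ≤
        (Icc r₀ R).indicator (fun r => K / (A r * ∫ s in r₀..R, (A s)⁻¹)) ‖x‖ := by
  have hS1 : ContDiff ℝ 1 Real.smoothTransition := Real.smoothTransition.contDiff (n := 1)
  have hSd : Continuous (deriv Real.smoothTransition) := hS1.continuous_deriv le_rfl
  obtain ⟨K, hK⟩ := (isCompact_Icc (a := (0:ℝ)) (b := 1)).exists_bound_of_continuousOn hSd.continuousOn
  refine ⟨max K 1, by positivity, fun m A r₀ R hA hApos hr₀ hR => ?_⟩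
  have hAi : Continuous fun s => (A s)⁻¹ := hA.inv₀ fun s => (hApos s).ne'
  set T : ℝ → ℝ := fun r => ∫ s in r₀..r, (A s)⁻¹ with hT
  have hTd : ∀ r, HasDerivAt T (A r)⁻¹ r := fun r =>
    (hAi.integral_hasStrictDerivAt r₀ r).hasDerivAt
  have hTmono : StrictMono T := strictMono_of_deriv_pos fun r => by
    rw [(hTd r).deriv]; exact inv_pos.2 (hApos r)
  have hT0 : T r₀ = 0 := by simp [hT]
  have hTR : 0 < T R := by rw [← hT0]; exact hTmono hR
  have hT1 : ContDiff ℝ 1 T := by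
    rw [contDiff_one_iff_deriv]
    refine ⟨fun r => (hTd r).differentiableAt, ?_⟩
    rw [show deriv T = fun s => (A s)⁻¹ from funext fun r => (hTd r).deriv]
    exact hAi
  set ψ : ℝ → ℝ := fun r => 1 - Real.smoothTransition (T r / T R) with hψ
  have hψ1 : ContDiff ℝ 1 ψ := contDiff_const.sub (hS1.comp (hT1.div_const _))
  have hψlow : ∀ r ≤ r₀, ψ r = 1 := by
    intro r hr
    have : T r / T R ≤ 0 := div_nonpos_of_nonpos_of_nonneg (by rw [← hT0]; exact hTmono.monotone hr) hTR.le
    simp [hψ, Real.smoothTransition.zero_of_nonpos this]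
  have hψhigh : ∀ r, R ≤ r → ψ r = 0 := by
    intro r hr
    have : 1 ≤ T r / T R := by rw [le_div_iff₀ hTR, one_mul]; exact hTmono.monotone hr
    simp [hψ, Real.smoothTransition.one_of_one_le this]
  have hnear : ∀ x : EuclideanSpace ℝ (Fin m), ‖x‖ < r₀ → (fun x => ψ ‖x‖) =ᶠ[nhds x] fun _ => 1 := by
    intro x hx
    filter_upwards [continuous_norm.continuousAt.eventually_lt_const hx] with y hy
    exact hψlow _ (le_of_lt hy)
  refine ⟨fun x => ψ ‖x‖, ?_, ?_, fun x hx => hψlow _ hx, ?_⟩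
  · rw [contDiff_iff_contDiffAt]
    intro x
    rcases eq_or_ne x 0 with rfl | hx
    · exact contDiffAt_const.congr_of_eventuallyEq (hnear 0 (by simpa using hr₀))
    · exact hψ1.contDiffAt.comp x (contDiffAt_norm ℝ hx)
  · refine HasCompactSupport.intro (isCompact_closedBall (0 : EuclideanSpace ℝ (Fin m)) R) ?_
    intro x hx
    refine hψhigh _ ?_
    simp at hx
    exact hx.le
  · intro x
    rcases lt_or_ge ‖x‖ r₀ with h1 | h1
    · rw [(hnear x h1).fderiv_eq]
      simp [h1]
    rcases lt_or_ge R ‖x‖ with h2 | h2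
    · have : (fun x : EuclideanSpace ℝ (Fin m) => ψ ‖x‖) =ᶠ[nhds x] fun _ => 0 := by
        filter_upwards [continuous_norm.continuousAt.eventually_const_lt h2] with y hy
        exact hψhigh _ (le_of_lt hy)
      rw [this.fderiv_eq]
      simp [h2]
    have hmemR : ‖x‖ ∈ Icc r₀ R := ⟨h1, h2⟩
    rw [indicator_of_mem hmemR]
    have hx0 : x ≠ 0 := by
      rintro rfl
      simp at h1; linarith
    have hd : HasDerivAt ψ (-(deriv Real.smoothTransition (T ‖x‖ / T R) * ((A ‖x‖)⁻¹ / T R))) ‖x‖ := by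
      have := (hS1.differentiable one_ne_zero (T ‖x‖ / T R)).hasDerivAt.comp ‖x‖
        ((hTd ‖x‖).div_const (T R))
      simpa using this.const_sub 1
    have hf := hd.comp_hasFDerivAt x
      ((contDiffAt_norm ℝ hx0 (n := 1)).differentiableAt one_ne_zero).hasFDerivAt
    have e : fderiv ℝ (fun x : EuclideanSpace ℝ (Fin m) => ψ ‖x‖) x = _ := hf.fderiv
    rw [e, norm_smul]
    have hn : ‖fderiv ℝ (norm : EuclideanSpace ℝ (Fin m) → ℝ) x‖ ≤ 1 := by
      simpa using norm_fderiv_le_of_lipschitz ℝ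
        (lipschitzWith_one_norm (E := EuclideanSpace ℝ (Fin m))) (x₀ := x)
    have hmem : T ‖x‖ / T R ∈ Icc (0:ℝ) 1 := by
      constructor
      · exact div_nonneg (by rw [← hT0]; exact hTmono.monotone h1) hTR.le
      · rw [div_le_one hTR]; exact hTmono.monotone h2
    have hAx := hApos ‖x‖
    have hpos : 0 < (A ‖x‖)⁻¹ / T R := by positivity
    calc _ ≤ ‖-(deriv Real.smoothTransition (T ‖x‖ / T R) * ((A ‖x‖)⁻¹ / T R))‖ * 1 := by gcongr
      _ = ‖deriv Real.smoothTransition (T ‖x‖ / T R)‖ * ((A ‖x‖)⁻¹ / T R) := by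
          rw [mul_one, norm_neg, norm_mul, Real.norm_of_nonneg hpos.le]
      _ ≤ max K 1 * ((A ‖x‖)⁻¹ / T R) := by
          gcongr
          exact (hK _ hmem).trans (le_max_left _ _)
      _ = max K 1 / (A ‖x‖ * T R) := by field_simp

/-- nonexistence under a positive supersolution of `Δφ + H a φ ≤ 0`
(Euclidean case). -/
theorem stmt_10 {m : ℕ} (hm : 2 ≤ m) (a b : EuclideanSpace ℝ (Fin m) → ℝ)
    (ha : Continuous a) (hb : Continuous b)
    (hbnn : ∀ x, 0 ≤ b x) (hbne : ∃ x, b x ≠ 0)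
    (H : ℝ) (hH : 1 ≤ H)
    (φ : EuclideanSpace ℝ (Fin m) → ℝ) (hφC2 : ContDiff ℝ 2 φ) (hφpos : ∀ x, 0 < φ x)
    (hφ : ∀ x, lap φ x + H * a x * φ x ≤ 0)
    (σ : ℝ) :
    ¬ ∃ u : EuclideanSpace ℝ (Fin m) → ℝ, ContDiff ℝ 2 u ∧ (∀ x, 0 < u x) ∧
      (∀ x, 0 ≤ lap u x + a x * u x - b x * u x ^ σ) ∧
      ∃ β : ℝ, 0 ≤ β ∧ β ≤ H - 1 ∧
        ∃ R : ℝ, ∀ r₀ ≥ R, ¬ IntegrableOn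
          (fun r : ℝ =>
            (∫ x in sphere (0 : EuclideanSpace ℝ (Fin m)) r,
              u x ^ (2 * (β + 1)) ∂μH[(m : ℝ) - 1])⁻¹)
          (Set.Ici r₀) := by
  rintro ⟨u, hu, hu0, hus, β, hβ0, hβH, R₁, hnot⟩
  have hm0 : 0 < m := by omega
  have : Nonempty (Fin m) := ⟨⟨0, hm0⟩⟩
  set α := β + 1 with hα
  have huc := hu.continuous
  have hup : ∀ p : ℝ, Continuous fun x => u x ^ p := fun p =>
    huc.rpow_const fun x => Or.inl (hu0 x).ne'
  have hW : ∀ x, 0 < u x ^ (2 * α) := fun x => Real.rpow_pos_of_pos (hu0 x) _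
  have hWr : ∀ r : ℝ, Continuous fun ω : sphere (0 : EuclideanSpace ℝ (Fin m)) 1 =>
      u (r • ω.1) ^ (2 * α) := fun r => (hup (2 * α)).comp (by fun_prop)
  by_cases hfin : IsFiniteMeasure (μH[(m:ℝ) - 1] : Measure (sphere (0 : EuclideanSpace ℝ (Fin m)) 1))
  swap
  · -- degenerate case: the integrals all vanish
    refine hnot (max R₁ 1) (le_max_left _ _) ?_
    have h0 : IntegrableOn (fun _ : ℝ => (0:ℝ)) (Ici (max R₁ 1)) := integrableOn_zero
    refine h0.congr_fun ?_ measurableSet_Ici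
    intro r hr
    have hr1 : 1 ≤ r := (le_max_right _ _).trans hr
    simp only
    rw [aux_sphere hm r (by linarith), integral_undef, mul_zero, inv_zero]
    intro hint
    obtain ⟨ω₀, -, hω₀⟩ := (isCompact_univ (X := sphere (0 : EuclideanSpace ℝ (Fin m)) 1)).exists_isMinOn
      (by
        have : Nontrivial (EuclideanSpace ℝ (Fin m)) := inferInstance
        obtain ⟨x, hx⟩ := NormedSpace.sphere_nonempty (E := EuclideanSpace ℝ (Fin m)) (x := 0)
          (r := 1) |>.2 zero_le_one
        exact ⟨⟨x, hx⟩, mem_univ _⟩) (hWr r).continuousOn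
    have hc : Integrable (fun _ : sphere (0 : EuclideanSpace ℝ (Fin m)) 1 =>
        u (r • ω₀.1) ^ (2 * α)) μH[(m:ℝ) - 1] := by
      refine hint.mono' aestronglyMeasurable_const (ae_of_all _ fun ω => ?_)
      rw [Real.norm_of_nonneg (hW _).le]
      exact hω₀ (mem_univ ω)
    rcases integrable_const_iff.1 hc with h | h
    · exact (hW _).ne' h
    · exact hfin h
  -- main case
  set I : ℝ → ℝ := fun r => ∫ ω : sphere (0 : EuclideanSpace ℝ (Fin m)) 1,
    u (r • ω.1) ^ (2 * α) ∂μH[(m:ℝ) - 1] with hI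
  have hIc : Continuous I := by
    have := continuous_parametric_integral_of_continuous
      (μ := (μH[(m:ℝ) - 1] : Measure (sphere (0 : EuclideanSpace ℝ (Fin m)) 1)))
      (f := fun (r : ℝ) (ω : sphere (0 : EuclideanSpace ℝ (Fin m)) 1) => u (r • ω.1) ^ (2 * α))
      ((hup (2 * α)).comp (by fun_prop)) isCompact_univ
    simpa [hI] using this
  have hIint : ∀ r : ℝ, Integrable (fun ω : sphere (0 : EuclideanSpace ℝ (Fin m)) 1 =>
      u (r • ω.1) ^ (2 * α)) μH[(m:ℝ) - 1] := fun r =>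
    (hWr r).integrable_of_hasCompactSupport (HasCompactSupport.of_compactSpace _)
  have hνne : (μH[(m:ℝ) - 1] : Measure (sphere (0 : EuclideanSpace ℝ (Fin m)) 1)) ≠ 0 := by
    intro h0
    obtain ⟨C, -, hle⟩ := aux_toSphere_le hm
    rw [h0, smul_zero] at hle
    exact Measure.toSphere_ne_zero _ (le_antisymm hle (Measure.zero_le _))
  have hIpos : ∀ r, 0 < I r := by
    intro r
    rw [hI, integral_pos_iff_support_of_nonneg (fun ω => (hW _).le) (hIint r)]
    have : (Function.support fun ω : sphere (0 : EuclideanSpace ℝ (Fin m)) 1 =>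
      u (r • ω.1) ^ (2 * α)) = univ := by
      ext ω; simp [(hW _).ne']
    rw [this]
    exact Measure.measure_univ_pos.2 hνne
  obtain ⟨xb, hxb⟩ := hbne
  set r₀ := max (max R₁ 1) (‖xb‖ + 1) with hr₀
  have hr₀1 : 1 ≤ r₀ := (le_max_right _ _).trans (le_max_left _ _)
  have hr₀R : R₁ ≤ r₀ := (le_max_left _ _).trans (le_max_left _ _)
  have hr₀b : ‖xb‖ < r₀ := (lt_add_one _).trans_le (le_max_right _ _)
  set A : ℝ → ℝ := fun r => max r r₀ ^ (m - 1) * I (max r r₀) with hA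
  have hAc : Continuous A := by
    have h : Continuous fun r : ℝ => max r r₀ := continuous_id.max continuous_const
    exact (h.pow _).mul (hIc.comp h)
  have hApos : ∀ r, 0 < A r := by
    intro r
    have : 0 < max r r₀ := lt_of_lt_of_le (by linarith) (le_max_right _ _)
    have := hIpos (max r r₀)
    positivity
  have hAi : Continuous fun s => (A s)⁻¹ := hAc.inv₀ fun s => (hApos s).ne'
  have hAeq : ∀ r, r₀ ≤ r → A r = r ^ (m - 1) * I r := by
    intro r hr; simp [hA, max_eq_left hr]
  -- the reference quantity
  set B : EuclideanSpace ℝ (Fin m) → ℝ := fun x => u x ^ (2 * α) * (b x * u x ^ σ / u x) with hB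
  have hBc : Continuous B := (hup _).mul ((hb.mul (hup _)).div huc fun x => (hu0 x).ne')
  have hB0 : ∀ x, 0 ≤ B x := fun x => by
    have h1 := hW x
    have h2 := hbnn x
    have h3 := hu0 x
    have h4 := Real.rpow_pos_of_pos h3 σ
    positivity
  have hBint : IntegrableOn B (closedBall 0 r₀) :=
    hBc.continuousOn.integrableOn_compact (isCompact_closedBall _ _)
  set c := ∫ x in closedBall (0 : EuclideanSpace ℝ (Fin m)) r₀, B x with hc
  have hcpos : 0 < c := by
    rw [hc, setIntegral_pos_iff_support_of_nonneg_ae (ae_of_all _ hB0) hBint]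
    have hopen : IsOpen (Function.support B ∩ ball 0 r₀) := hBc.isOpen_support.inter isOpen_ball
    refine (hopen.measure_pos volume ⟨xb, ?_, by simpa using hr₀b⟩).trans_le
      (measure_mono (inter_subset_inter_right _ ball_subset_closedBall))
    have h3 := hu0 xb
    have h4 := Real.rpow_pos_of_pos h3 σ
    have h1 := hW xb
    simp only [Function.mem_support, hB]
    positivity
  obtain ⟨C, hCtop, hpolar⟩ := aux_polar hm
  obtain ⟨K, hK0, hcut⟩ := aux_cutoff
  -- key bound
  have key : ∀ R, r₀ < R → ∫ s in r₀..R, (A s)⁻¹ ≤ C.toReal * (m * K ^ 2) / c := by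
    intro R hR
    set T := ∫ s in r₀..R, (A s)⁻¹ with hT
    have hTpos : 0 < T := intervalIntegral.intervalIntegral_pos_of_pos
      (hAi.intervalIntegrable _ _) (fun s => inv_pos.2 (hApos s)) hR
    obtain ⟨η, hη1, hηc, hηone, hηd⟩ := hcut m A r₀ R hAc hApos (by linarith) hR
    have hen := aux_energy a b hb u φ η hu hφC2 hu0 hφpos H α σ hH (by linarith) (by linarith)
      hφ hus hη1 hηc
    have hcle : c ≤ ∫ x, η x ^ 2 * B x := by
      have hint : Integrable (fun x => η x ^ 2 * B x) := by
        refine Continuous.integrable_of_hasCompactSupport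
          ((hη1.continuous.pow 2).mul hBc) (hηc.mono ?_)
        intro x hx hx'
        exact hx (by simp [hx'])
      rw [hc, ← integral_indicator isClosed_closedBall.measurableSet]
      refine integral_mono (hBint.integrable_indicator isClosed_closedBall.measurableSet) hint ?_
      intro x
      by_cases hx : x ∈ closedBall (0 : EuclideanSpace ℝ (Fin m)) r₀
      · simp only [indicator_of_mem hx]
        rw [hηone x (by simpa using hx)]; simp
      · simp only [indicator_of_notMem hx]
        have := hB0 x
        positivity
    have hup2 : ∫ x, u x ^ (2 * α) * ((m : ℝ) * ‖fderiv ℝ η x‖ ^ 2) ≤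
        C.toReal * (m * K ^ 2) / T := by
      have hdη := hη1.continuous_fderiv one_ne_zero
      have hWc := hup (2 * α)
      set g : ℝ → ℝ := (Icc r₀ R).indicator (fun r => (m:ℝ) * (K / (A r * T)) ^ 2) with hg
      have hgm : Measurable g := by
        refine Measurable.indicator ?_ measurableSet_Icc
        have := hAc.measurable
        fun_prop
      rw [integral_eq_lintegral_of_nonneg_ae (ae_of_all _ fun x => by
        have := hW x
        simp only [Pi.zero_apply]
        positivity) (by
          refine Continuous.aestronglyMeasurable ?_
          exact hWc.mul (continuous_const.mul (hdη.norm.pow 2)))]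
      have hb1 : ∫⁻ x, ENNReal.ofReal (u x ^ (2 * α) * ((m : ℝ) * ‖fderiv ℝ η x‖ ^ 2)) ≤
          C * ENNReal.ofReal (m * K ^ 2 / T) := by
        calc _ ≤ ∫⁻ x, ENNReal.ofReal (u x ^ (2 * α)) * ENNReal.ofReal (g ‖x‖) := by
              refine lintegral_mono fun x => ?_
              rw [← ENNReal.ofReal_mul (hW x).le]
              apply ENNReal.ofReal_le_ofReal
              have h1 := hηd x
              have h2 := (hW x).le
              refine mul_le_mul_of_nonneg_left ?_ h2
              by_cases hx : ‖x‖ ∈ Icc r₀ R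
              · rw [indicator_of_mem hx] at h1
                rw [hg, indicator_of_mem hx]
                gcongr
              · rw [indicator_of_notMem hx] at h1
                have h0 : ‖fderiv ℝ η x‖ = 0 := le_antisymm h1 (norm_nonneg _)
                rw [hg, indicator_of_notMem hx, h0]
                simp
          _ ≤ _ := hpolar (fun x => ENNReal.ofReal (u x ^ (2 * α)))
              (fun r => ENNReal.ofReal (g r)) hWc.measurable.ennreal_ofReal hgm.ennreal_ofReal
          _ ≤ _ := by
              gcongr
              calc _ ≤ ∫⁻ r in Ioi (0:ℝ), (Icc r₀ R).indicator
                    (fun r => ENNReal.ofReal (m * K ^ 2 / T ^ 2 * (A r)⁻¹)) r := by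
                    refine setLIntegral_mono' measurableSet_Ioi fun r hr => ?_
                    by_cases hx : r ∈ Icc r₀ R
                    · rw [hg, indicator_of_mem hx, indicator_of_mem hx,
                        ← ofReal_integral_eq_lintegral_ofReal (hIint r)
                          (ae_of_all _ fun ω => (hW _).le),
                        ← ENNReal.ofReal_mul (pow_nonneg (le_of_lt hr) _),
                        ← ENNReal.ofReal_mul (by positivity)]
                      apply ENNReal.ofReal_le_ofReal
                      have h5 := hAeq r hx.1
                      simp only [hI] at h5
                      rw [← h5]
                      have := hApos r
                      apply le_of_eq
                      field_simp
                    · simp only [hg, indicator_of_notMem hx]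
                      simp
                _ ≤ ∫⁻ r, (Icc r₀ R).indicator
                    (fun r => ENNReal.ofReal (m * K ^ 2 / T ^ 2 * (A r)⁻¹)) r :=
                    setLIntegral_le_lintegral _ _
                _ = ∫⁻ r in Icc r₀ R, ENNReal.ofReal (m * K ^ 2 / T ^ 2 * (A r)⁻¹) :=
                    lintegral_indicator measurableSet_Icc _
                _ = ENNReal.ofReal (∫ r in Icc r₀ R, m * K ^ 2 / T ^ 2 * (A r)⁻¹) := by
                    rw [ofReal_integral_eq_lintegral_ofReal]
                    · exact ((hAi.const_mul _).continuousOn.integrableOn_compact isCompact_Icc)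
                    · refine ae_of_all _ fun r => ?_
                      have := hApos r
                      simp only [Pi.zero_apply]
                      positivity
                _ = _ := by
                    rw [integral_const_mul, integral_Icc_eq_integral_Ioc,
                      ← intervalIntegral.integral_of_le hR.le, ← hT]
                    congr 1
                    field_simp
      have hb2 := ENNReal.toReal_mono (ENNReal.mul_ne_top hCtop ENNReal.ofReal_ne_top) hb1
      rw [ENNReal.toReal_mul, ENNReal.toReal_ofReal (by positivity)] at hb2
      rw [mul_div_assoc]
      exact hb2
    have h := hcle.trans (hen.trans hup2)
    rw [le_div_iff₀ hTpos] at h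
    rw [le_div_iff₀ hcpos]
    linarith
  -- conclusion
  refine hnot r₀ hr₀R ?_
  have hIoi : IntegrableOn (fun s => (A s)⁻¹) (Ioi r₀) := by
    refine integrableOn_Ioi_of_intervalIntegral_norm_bounded (l := atTop) (b := id)
      (C.toReal * (m * K ^ 2) / c) r₀ (fun i => ?_) tendsto_id ?_
    · exact (hAi.continuousOn.integrableOn_compact isCompact_Icc).mono_set Ioc_subset_Icc_self
    · filter_upwards [eventually_gt_atTop r₀] with R hR
      refine le_trans (le_of_eq ?_) (key R hR)
      refine intervalIntegral.integral_congr fun s _ => ?_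
      exact Real.norm_of_nonneg (inv_pos.2 (hApos s)).le
  have hIci : IntegrableOn (fun s => (A s)⁻¹) (Ici r₀) := by
    rw [integrableOn_Ici_iff_integrableOn_Ioi]; exact hIoi
  refine hIci.congr_fun ?_ measurableSet_Ici
  intro r hr
  simp only
  rw [aux_sphere hm r (by have : r₀ ≤ r := hr; linarith), hAeq r hr]
end

section
/- Main nonexistence theorem (Euclidean case): Let a, b : ℝ^m → ℝ be continuous (m ≥ 2) with b > 0 on ℝ^m and b(x) ≥ C|x|^{−μ} for all sufficiently large |x|, for some constants C > 0 and 0 ≤ μ ≤ 2. Assume sup_{ℝ^m} a₊/b < +∞ and ∫_{B_r} a₊ dx = O(r^{2−μ} log r) as r → +∞, where a₊ = max(a, 0). Assume that for some H ≥ 1 there exists a positive C² function φ on ℝ^m with Δφ + H a(x) φ ≤ 0 on ℝ^m. Let A and σ satisfy A ≤ 1, A < H − 1, 1 < σ ≤ 2H + 1 and σ < 2H − A, and assume m ≤ 2 + (2−μ)·2H/(σ−1) (so that vol B_r = O(r^{2+(2−μ)2H/(σ−1)} log r)). Then the only nonnegative C² function u on ℝ^m satisfying u Δu + a(x) u² −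 b(x) u^{σ+1} ≥ −A |∇u|² on ℝ^m is u ≡ 0. -/
open MeasureTheory Metric Set Filter

lemma aux_norm_grad {m : ℕ} (u : EuclideanSpace ℝ (Fin m) → ℝ) (x : EuclideanSpace ℝ (Fin m)) :
    ‖gradient u x‖ ^ 2 = ∑ i, (fderiv ℝ u x (EuclideanSpace.single i 1)) ^ 2 := by
  rw [EuclideanSpace.real_norm_sq_eq]
  refine Finset.sum_congr rfl fun i _ => ?_
  have h : fderiv ℝ u x (EuclideanSpace.single i 1)
      = inner ℝ (gradient u x) (EuclideanSpace.single i 1) := by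
    simp [gradient]
  rw [h, EuclideanSpace.inner_single_right]
  simp

lemma aux_int_zero {m : ℕ} (f : EuclideanSpace ℝ (Fin m) → ℝ) (hf : ContDiff ℝ 1 f)
    (hc : HasCompactSupport f) (v : EuclideanSpace ℝ (Fin m)) :
    Integrable (fun x => fderiv ℝ f x v) ∧ ∫ x, fderiv ℝ f x v = 0 := by
  have hcont : Continuous fun x => fderiv ℝ f x v :=
    (hf.continuous_fderiv (by simp)).clm_apply continuous_const
  have hi : Integrable (fun x => fderiv ℝ f x v) :=
    hcont.integrable_of_hasCompactSupport (hc.fderiv_apply ℝ v)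
  refine ⟨hi, ?_⟩
  have := integral_mul_fderiv_eq_neg_fderiv_mul_of_integrable (μ := volume)
    (f := fun _ : EuclideanSpace ℝ (Fin m) => (1 : ℝ)) (g := f) (v := v)
    (by simp) (by simpa using hi)
    (by simpa using hf.continuous.integrable_of_hasCompactSupport hc)
    (fun x _ => differentiableAt_const _) (fun x _ => hf.differentiable (by simp) x)
  simpa using this

lemma aux_trans : ∃ M : ℝ, 0 ≤ M ∧ ∀ t, |deriv Real.smoothTransition t| ≤ M ∧
    (t < 0 ∨ 1 < t → deriv Real.smoothTransition t = 0) := by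
  have hc : Continuous (deriv Real.smoothTransition) :=
    (Real.smoothTransition.contDiff (n := 1)).continuous_deriv (by simp)
  have hz : ∀ t, (t < 0 ∨ 1 < t → deriv Real.smoothTransition t = 0) := by
    rintro t (h | h)
    · have : Real.smoothTransition =ᶠ[nhds t] fun _ => 0 := by
        filter_upwards [Iio_mem_nhds h] with s hs
        exact Real.smoothTransition.zero_of_nonpos (le_of_lt hs)
      rw [this.deriv_eq]; simp
    · have : Real.smoothTransition =ᶠ[nhds t] fun _ => 1 := by
        filter_upwards [Ioi_mem_nhds h] with s hs
        exact Real.smoothTransition.one_of_one_le (le_of_lt hs)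
      rw [this.deriv_eq]; simp
  obtain ⟨M, hM⟩ := (isCompact_Icc (a := (0:ℝ)) (b := 1)).exists_bound_of_continuousOn hc.continuousOn
  refine ⟨max M 0, le_max_right _ _, fun t => ⟨?_, hz t⟩⟩
  by_cases h : t ∈ Icc (0:ℝ) 1
  · exact (hM t h).trans (le_max_left _ _)
  · rw [hz t (by simp only [mem_Icc, not_and_or, not_le] at h; exact h)]; simp

/-- logarithmic cutoff -/
noncomputable def auxCut {m : ℕ} (L : ℝ) (x : EuclideanSpace ℝ (Fin m)) : ℝ :=
  Real.smoothTransition (2 - Real.log (1 + ‖x‖ ^ 2) / L)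

lemma auxCut_contDiff {m : ℕ} (L : ℝ) : ContDiff ℝ 1 (auxCut (m := m) L) := by
  unfold auxCut
  refine (Real.smoothTransition.contDiff (n := 1)).comp ?_
  refine contDiff_const.sub (ContDiff.div_const ?_ _)
  exact (contDiff_const.add (contDiff_norm_sq ℝ)).log fun x => by positivity

lemma auxCut_one {m : ℕ} {L : ℝ} (hL : 0 < L) (x : EuclideanSpace ℝ (Fin m))
    (h : Real.log (1 + ‖x‖ ^ 2) ≤ L) : auxCut L x = 1 := by
  apply Real.smoothTransition.one_of_one_le
  have : Real.log (1 + ‖x‖ ^ 2) / L ≤ 1 := (div_le_one hL).2 h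
  linarith

lemma auxCut_zero {m : ℕ} {L : ℝ} (hL : 0 < L) (x : EuclideanSpace ℝ (Fin m))
    (h : 2 * L ≤ Real.log (1 + ‖x‖ ^ 2)) : auxCut L x = 0 := by
  apply Real.smoothTransition.zero_of_nonpos
  have : 2 ≤ Real.log (1 + ‖x‖ ^ 2) / L := (le_div_iff₀ hL).2 h
  linarith

lemma auxCut_supp {m : ℕ} {L : ℝ} (hL : 0 < L) :
    HasCompactSupport (auxCut (m := m) L) := by
  refine HasCompactSupport.intro (isCompact_closedBall 0 (Real.exp L)) fun x hx => ?_
  refine auxCut_zero hL x ?_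
  simp only [mem_closedBall, dist_zero_right, not_le] at hx
  rw [Real.le_log_iff_exp_le (by positivity), two_mul, Real.exp_add]
  nlinarith [Real.exp_pos L]

lemma auxCut_grad {m : ℕ} (M : ℝ) (hM : ∀ t, |deriv Real.smoothTransition t| ≤ M ∧
    (t < 0 ∨ 1 < t → deriv Real.smoothTransition t = 0)) {L : ℝ} (hL : 1 ≤ L)
    (x : EuclideanSpace ℝ (Fin m)) :
    (∑ i, (fderiv ℝ (auxCut L) x (EuclideanSpace.single i 1)) ^ 2 = 0) ∨
    (L ≤ ‖x‖ ^ 2 ∧ ‖x‖ ≤ Real.exp L ∧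
      ∑ i, (fderiv ℝ (auxCut L) x (EuclideanSpace.single i 1)) ^ 2 ≤ 4 * M ^ 2 / (L ^ 2 * ‖x‖ ^ 2)) := by
  set s : ℝ := 1 + ‖x‖ ^ 2 with hs
  have hs0 : 0 < s := by positivity
  have hL0 : 0 < L := by linarith
  set t : ℝ := 2 - Real.log s / L with ht
  have hder : ∀ i, fderiv ℝ (auxCut L) x (EuclideanSpace.single i 1)
      = deriv Real.smoothTransition t * (-(2 * x i / s / L)) := by
    intro i
    have h1 : HasFDerivAt (fun y : EuclideanSpace ℝ (Fin m) => ‖y‖ ^ 2) (2 • (innerSL ℝ x)) x :=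
      (hasStrictFDerivAt_norm_sq x).hasFDerivAt
    have h2 : HasFDerivAt (fun y : EuclideanSpace ℝ (Fin m) => 2 - Real.log (1 + ‖y‖ ^ 2) * L⁻¹)
        (-(L⁻¹ • (s⁻¹ • (2 • (innerSL ℝ x))))) x := by
      have := (((h1.const_add 1).log hs0.ne').mul_const L⁻¹).const_sub 2
      exact this
    have h3 : HasDerivAt Real.smoothTransition (deriv Real.smoothTransition t)
        (2 - Real.log (1 + ‖x‖ ^ 2) * L⁻¹) := by
      rw [ht, div_eq_mul_inv]
      exact ((Real.smoothTransition.contDiff (n := 1)).differentiable (by simp) _).hasDerivAt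
    have h4 := h3.comp_hasFDerivAt x h2
    have h5 : (auxCut L : EuclideanSpace ℝ (Fin m) → ℝ)
        = Real.smoothTransition ∘ (fun y => 2 - Real.log (1 + ‖y‖ ^ 2) * L⁻¹) := by
      ext y; simp [auxCut, div_eq_mul_inv]
    rw [h5, h4.fderiv]
    simp [EuclideanSpace.inner_single_right]
    left
    field_simp
  have hsum : ∑ i, (fderiv ℝ (auxCut L) x (EuclideanSpace.single i 1)) ^ 2
      = (deriv Real.smoothTransition t) ^ 2 * (4 * ‖x‖ ^ 2 / (s ^ 2 * L ^ 2)) := by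
    rw [EuclideanSpace.real_norm_sq_eq, Finset.mul_sum, Finset.sum_div, Finset.mul_sum]
    refine Finset.sum_congr rfl fun i _ => ?_
    rw [hder i]; field_simp; ring
  by_cases hout : t < 0 ∨ 1 < t
  · left; rw [hsum, (hM t).2 hout]; simp
  right
  push Not at hout
  obtain ⟨h0, h1⟩ := hout
  have hl1 : L ≤ Real.log s := by
    have : 1 ≤ Real.log s / L := by linarith
    rwa [le_div_iff₀ hL0, one_mul] at this
  have hl2 : Real.log s ≤ 2 * L := by
    have : Real.log s / L ≤ 2 := by linarith
    rwa [div_le_iff₀ hL0] at this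
  rw [Real.le_log_iff_exp_le hs0] at hl1
  rw [Real.log_le_iff_le_exp hs0, two_mul, Real.exp_add] at hl2
  have hLx : L ≤ ‖x‖ ^ 2 := by
    have := Real.add_one_le_exp L
    linarith
  refine ⟨hLx, ?_, ?_⟩
  · by_contra! h
    nlinarith [Real.exp_pos L]
  · rw [hsum]
    have hx0 : 0 < ‖x‖ ^ 2 := by linarith
    have hD : (deriv Real.smoothTransition t) ^ 2 ≤ M ^ 2 := sq_le_sq.2 (((hM t).1).trans (le_abs_self M))
    have h6 : 4 * ‖x‖ ^ 2 / (s ^ 2 * L ^ 2) ≤ 4 / (L ^ 2 * ‖x‖ ^ 2) := by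
      rw [div_le_div_iff₀ (by positivity) (by positivity)]
      have : ‖x‖ ^ 2 * ‖x‖ ^ 2 ≤ s ^ 2 := by rw [hs]; nlinarith
      nlinarith [mul_le_mul_of_nonneg_right this (sq_nonneg L)]
    calc _ ≤ M ^ 2 * (4 / (L ^ 2 * ‖x‖ ^ 2)) := mul_le_mul hD h6 (by positivity) (by positivity)
      _ = _ := by ring

/-- radial majorant -/
noncomputable def auxRad (m : ℕ) (R : ℝ) : ℝ → ℝ := indicator (Icc 1 R) fun r => (r ^ m)⁻¹

lemma auxRad_int {m : ℕ} (hm : 2 ≤ m) {R : ℝ} (hR : 1 ≤ R) :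
    Integrable (fun x : EuclideanSpace ℝ (Fin m) => auxRad m R ‖x‖) ∧
    ∫ x : EuclideanSpace ℝ (Fin m), auxRad m R ‖x‖
      = m * (volume.real (ball (0 : EuclideanSpace ℝ (Fin m)) 1)) * Real.log R := by
  have : Nonempty (Fin m) := ⟨⟨0, by omega⟩⟩
  have : Nontrivial (EuclideanSpace ℝ (Fin m)) := inferInstance
  have heq : (fun y : ℝ => y ^ (m - 1) • auxRad m R y) = indicator (Icc 1 R) fun r => r⁻¹ := by
    ext y
    by_cases hy : y ∈ Icc 1 R
    · simp only [auxRad, indicator_of_mem hy, smul_eq_mul]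
      have hy0 : y ≠ 0 := by have := hy.1; positivity
      obtain ⟨k, rfl⟩ : ∃ k, m = k + 1 := ⟨m - 1, by omega⟩
      simp only [Nat.add_sub_cancel]
      field_simp
      ring
    · simp [auxRad, indicator_of_notMem hy]
  have hsub : Icc 1 R ⊆ Ioi (0:ℝ) := fun y hy => lt_of_lt_of_le one_pos hy.1
  have hion : IntegrableOn (fun r : ℝ => r⁻¹) (Icc 1 R) :=
    ContinuousOn.integrableOn_Icc (continuousOn_inv₀.mono fun y hy => (hsub hy).ne')
  constructor
  · rw [integrable_fun_norm_addHaar, finrank_euclideanSpace_fin, heq]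
    exact ((integrable_indicator_iff measurableSet_Icc).2 hion).integrableOn
  · rw [integral_fun_norm_addHaar, finrank_euclideanSpace_fin, heq,
      setIntegral_indicator measurableSet_Icc, inter_eq_right.2 hsub,
      integral_Icc_eq_integral_Ioc, ← intervalIntegral.integral_of_le hR,
      integral_inv_of_pos one_pos (by linarith)]
    simp [mul_assoc]

lemma aux_young {z v b T c β σ H : ℝ} (n : ℕ) (hz0 : 0 ≤ z) (hz1 : z ≤ 1) (hv : 0 ≤ v)
    (hb : 0 < b) (hT : 0 ≤ T) (hc : 0 ≤ c) (hσ : 1 < σ) (hH : 1 ≤ H)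
    (hβ : β = 2 * H / (σ - 1)) (hn : 2 * β ≤ n) :
    c * z ^ n * v ^ (2 * H) * T
      ≤ 1 / 2 * (z ^ (n + 2) * (b * v ^ (σ - 1 + 2 * H))) + c * T * (2 * c * T / b) ^ β := by
  have hσ' : 0 < σ - 1 := by linarith
  have hβ0 : 0 < β := by rw [hβ]; positivity
  have hvs : v ^ (σ - 1 + 2 * H) = v ^ (σ - 1) * v ^ (2 * H) :=
    Real.rpow_add_of_nonneg hv hσ'.le (by linarith)
  have hY : 0 ≤ 2 * c * T / b := by positivity
  by_cases h : c * T ≤ 1 / 2 * (z ^ 2 * b * v ^ (σ - 1))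
  · have h1 := mul_le_mul_of_nonneg_left h (show 0 ≤ z ^ n * v ^ (2 * H) by positivity)
    have h2 : 0 ≤ c * T * (2 * c * T / b) ^ β := by positivity
    rw [hvs]
    calc _ = z ^ n * v ^ (2 * H) * (c * T) := by ring
      _ ≤ _ := h1
      _ = 1 / 2 * (z ^ (n + 2) * (b * (v ^ (σ - 1) * v ^ (2 * H)))) := by ring
      _ ≤ _ := by linarith
  · push Not at h
    have h1 : z ^ 2 * v ^ (σ - 1) ≤ 2 * c * T / b := by
      rw [le_div_iff₀ hb]; linarith
    have h2 : z ^ n * v ^ (2 * H) ≤ (2 * c * T / b) ^ β := by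
      calc z ^ n * v ^ (2 * H) ≤ z ^ (2 * β) * v ^ (2 * H) := by
            gcongr
            rw [← Real.rpow_natCast]
            exact Real.rpow_le_rpow_of_exponent_ge' hz0 hz1 (by positivity) hn
        _ = (z ^ 2 * v ^ (σ - 1)) ^ β := by
            rw [Real.mul_rpow (by positivity) (by positivity), ← Real.rpow_mul hv,
              ← Real.rpow_natCast, ← Real.rpow_mul hz0]
            congr 2
            rw [hβ]; field_simp
        _ ≤ _ := Real.rpow_le_rpow (by positivity) h1 hβ0.le
    have h3 := mul_le_mul_of_nonneg_left h2 (show 0 ≤ c * T by positivity)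
    have h4 : 0 ≤ 1 / 2 * (z ^ (n + 2) * (b * v ^ (σ - 1 + 2 * H))) := by positivity
    calc _ = c * T * (z ^ n * v ^ (2 * H)) := by ring
      _ ≤ _ := h3
      _ ≤ _ := by linarith

lemma aux_decay {c T M b C μ β L r : ℝ} {m : ℕ} (hc : 0 ≤ c) (hT : 0 ≤ T) (hC : 0 < C)
    (hr : 1 ≤ r) (hL : 1 ≤ L) (hβ : 0 ≤ β) (hTb : T ≤ 4 * M ^ 2 / (L ^ 2 * r ^ 2))
    (hb : C * r ^ (-μ) ≤ b) (hm : (m : ℝ) ≤ 2 + (2 - μ) * β) :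
    c * T * (2 * c * T / b) ^ β
      ≤ (c * (4 * M ^ 2) * (2 * c * (4 * M ^ 2) / C) ^ β) / L ^ 2 * (r ^ m)⁻¹ := by
  have hr0 : 0 < r := by linarith
  have hrμ : 0 < r ^ (-μ) := Real.rpow_pos_of_pos hr0 _
  have hT2 : T ≤ 4 * M ^ 2 * r ^ (-2 : ℝ) := by
    refine hTb.trans ?_
    rw [show (-2 : ℝ) = -((2 : ℕ) : ℝ) by norm_num, Real.rpow_neg hr0.le, Real.rpow_natCast,
      div_eq_mul_inv]
    gcongr
    exact le_mul_of_one_le_left (sq_nonneg r) (one_le_pow₀ hL)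
  have h1 : 2 * c * T / b ≤ (2 * c * (4 * M ^ 2) / C) * r ^ (μ - 2) := by
    calc 2 * c * T / b ≤ 2 * c * (4 * M ^ 2 * r ^ (-2 : ℝ)) / (C * r ^ (-μ)) := by gcongr
      _ = (2 * c * (4 * M ^ 2) / C) * (r ^ (-2 : ℝ) / r ^ (-μ)) := by field_simp
      _ = _ := by rw [← Real.rpow_sub hr0]; ring_nf
  have hb0 : 0 < b := lt_of_lt_of_le (by positivity) hb
  have h2 : (2 * c * T / b) ^ β ≤ (2 * c * (4 * M ^ 2) / C) ^ β * r ^ ((μ - 2) * β) := by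
    rw [Real.rpow_mul hr0.le, ← Real.mul_rpow (by positivity) (by positivity)]
    exact Real.rpow_le_rpow (by positivity) h1 hβ
  calc c * T * (2 * c * T / b) ^ β
      ≤ c * (4 * M ^ 2 / (L ^ 2 * r ^ 2)) * ((2 * c * (4 * M ^ 2) / C) ^ β * r ^ ((μ - 2) * β)) := by
        gcongr
    _ = (c * (4 * M ^ 2) * (2 * c * (4 * M ^ 2) / C) ^ β) / L ^ 2 * (r ^ ((μ - 2) * β) / r ^ 2) := by
        field_simp
    _ ≤ _ := by
        gcongr
        rw [← Real.rpow_natCast r 2, ← Real.rpow_sub hr0, ← Real.rpow_natCast r m,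
          ← Real.rpow_neg hr0.le]
        apply Real.rpow_le_rpow_of_exponent_le hr
        push_cast
        linarith

/-- the vector field -/
noncomputable def auxF {m : ℕ} (n : ℕ) (H : ℝ) (z u φ : EuclideanSpace ℝ (Fin m) → ℝ) (i : Fin m)
    (y : EuclideanSpace ℝ (Fin m)) : ℝ :=
  z y ^ (n + 2) * (u y ^ (2 * H - 1) * fderiv ℝ u y (EuclideanSpace.single i 1)
    - u y ^ (2 * H) * (fderiv ℝ φ y (EuclideanSpace.single i 1) * (H * φ y)⁻¹))

lemma aux_pd {m : ℕ} {u : EuclideanSpace ℝ (Fin m) → ℝ} (hu : ContDiff ℝ 2 u)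
    (v : EuclideanSpace ℝ (Fin m)) : ContDiff ℝ 1 (fun y => fderiv ℝ u y v) :=
  (hu.fderiv_right (m := 1) (by norm_num)).clm_apply contDiff_const

lemma auxF_contDiff {m : ℕ} (n : ℕ) {H : ℝ} (hH : 1 ≤ H) {z u φ : EuclideanSpace ℝ (Fin m) → ℝ}
    (hz : ContDiff ℝ 1 z) (hu : ContDiff ℝ 2 u) (hφ : ContDiff ℝ 2 φ) (hpos : ∀ x, 0 < φ x)
    (i : Fin m) : ContDiff ℝ 1 (auxF n H z u φ i) := by
  have hu1 : ContDiff ℝ 1 u := hu.of_le (by norm_num)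
  have hφ1 : ContDiff ℝ 1 φ := hφ.of_le (by norm_num)
  unfold auxF
  refine (hz.pow _).mul (ContDiff.sub (ContDiff.mul ?_ (aux_pd hu _))
    (ContDiff.mul ?_ ((aux_pd hφ _).mul ?_)))
  · exact hu1.rpow_const_of_le (by norm_num; linarith)
  · exact hu1.rpow_const_of_le (by norm_num; linarith)
  · exact (contDiff_const.mul hφ1).inv fun x => (mul_pos (by linarith) (hpos x)).ne'

lemma auxF_fderiv {m : ℕ} (n : ℕ) {H : ℝ} (hH : 1 ≤ H) {z u φ : EuclideanSpace ℝ (Fin m) → ℝ}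
    (hz : ContDiff ℝ 1 z) (hu : ContDiff ℝ 2 u) (hφ : ContDiff ℝ 2 φ) (hpos : ∀ x, 0 < φ x)
    (hunn : ∀ x, 0 ≤ u x)
    (i : Fin m) (x v : EuclideanSpace ℝ (Fin m)) (hv : v = EuclideanSpace.single i 1) :
    fderiv ℝ (auxF n H z u φ i) x v =
      (n + 2) * z x ^ (n + 1) * fderiv ℝ z x v * (u x ^ (2 * H - 2) * u x *
        (fderiv ℝ u x v - u x * (fderiv ℝ φ x v / (H * φ x))))
      + z x ^ (n + 2) * u x ^ (2 * H - 2) * ((2 * H - 1) * (fderiv ℝ u x v) ^ 2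
        + u x * fderiv ℝ (fun y => fderiv ℝ u y v) x v
        - 2 * H * u x * fderiv ℝ u x v * (fderiv ℝ φ x v / (H * φ x))
        - u x ^ 2 * (fderiv ℝ (fun y => fderiv ℝ φ y v) x v / (H * φ x)
          - H * (fderiv ℝ φ x v / (H * φ x)) ^ 2)) := by
  subst hv
  set e : EuclideanSpace ℝ (Fin m) := EuclideanSpace.single i 1 with he
  have hH0 : 0 < H := by linarith
  have hφx := hpos x
  have q1 : u x ^ (2 * H - 1) = u x ^ (2 * H - 2) * u x := by
    conv_rhs => rw [← Real.rpow_one (u x)]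
    rw [Real.rpow_one (u x), ← Real.rpow_add_one' (hunn x) (by linarith)]; ring_nf
  have q2 : u x ^ (2 * H) = u x ^ (2 * H - 2) * u x ^ 2 := by
    rw [pow_two, ← mul_assoc, ← q1, ← Real.rpow_add_one' (hunn x) (by linarith)]; ring_nf
  have du := (hu.differentiable (by norm_num) x).hasFDerivAt
  have dφ := (hφ.differentiable (by norm_num) x).hasFDerivAt
  have dz := (hz.differentiable (by norm_num) x).hasFDerivAt
  have duu := ((aux_pd hu e).differentiable (by norm_num) x).hasFDerivAt
  have dφφ := ((aux_pd hφ e).differentiable (by norm_num) x).hasFDerivAt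
  have d1 := du.rpow_const (p := 2 * H - 1) (Or.inr (by linarith))
  have d2 := du.rpow_const (p := 2 * H) (Or.inr (by linarith))
  have d3 := (dφ.const_mul H)
  have d3' := (hasDerivAt_inv (show H * φ x ≠ 0 by positivity)).comp_hasFDerivAt x d3
  have d4 := (dz.pow (n + 2)).mul ((d1.mul duu).sub (d2.mul (dφφ.mul d3')))
  have d5 : HasFDerivAt (auxF n H z u φ i) _ x := d4
  rw [d5.fderiv]
  simp only [add_apply, sub_apply,
    smul_apply, smul_eq_mul, Pi.mul_apply, Pi.sub_apply,
    Function.comp, nsmul_eq_mul]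
  rw [show 2 * H - 1 - 1 = 2 * H - 2 by ring, q1, q2]
  push_cast
  field_simp
  ring

lemma aux_div_term {H N z zi q u ui uii p w : ℝ} {n : ℕ} (hH : 0 < H) (hq : 0 ≤ q) (hz : 0 ≤ z) :
    z ^ (n + 2) * q * ((H - 1) * ui ^ 2 + u * uii - u ^ 2 * w)
      - N ^ 2 / (4 * H) * z ^ n * (q * u ^ 2) * zi ^ 2 ≤
    N * z ^ (n + 1) * zi * (q * u * (ui - u * p))
      + z ^ (n + 2) * q * ((2 * H - 1) * ui ^ 2 + u * uii - 2 * H * u * ui * p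
        - u ^ 2 * (w - H * p ^ 2)) := by
  have key : 0 ≤ z ^ n * q * H * (z * (ui - u * p) + N / (2 * H) * u * zi) ^ 2 := by positivity
  have : z ^ n * q * H * (z * (ui - u * p) + N / (2 * H) * u * zi) ^ 2 =
      (N * z ^ (n + 1) * zi * (q * u * (ui - u * p))
      + z ^ (n + 2) * q * ((2 * H - 1) * ui ^ 2 + u * uii - 2 * H * u * ui * p
        - u ^ 2 * (w - H * p ^ 2))) - (z ^ (n + 2) * q * ((H - 1) * ui ^ 2 + u * uii - u ^ 2 * w)
      - N ^ 2 / (4 * H) * z ^ n * (q * u ^ 2) * zi ^ 2) := by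
    field_simp
    ring
  linarith

set_option maxHeartbeats 1000000 in
/-- main nonexistence theorem (Euclidean case). -/
theorem stmt_12 {m : ℕ} (hm : 2 ≤ m) (a b : EuclideanSpace ℝ (Fin m) → ℝ)
    (ha : Continuous a) (hb : Continuous b) (hbpos : ∀ x, 0 < b x)
    (C μ : ℝ) (hC : 0 < C) (hμ0 : 0 ≤ μ) (hμ2 : μ ≤ 2)
    (hblow : ∃ r₀ : ℝ, ∀ x : EuclideanSpace ℝ (Fin m), r₀ ≤ ‖x‖ → C * ‖x‖ ^ (-μ) ≤ b x)
    (hsup : ∃ S : ℝ, ∀ x, max (a x) 0 / b x ≤ S)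
    (haO : ∃ C' r₁ : ℝ, ∀ r ≥ r₁,
      (∫ x in ball (0 : EuclideanSpace ℝ (Fin m)) r, max (a x) 0)
        ≤ C' * r ^ (2 - μ) * Real.log r)
    (H : ℝ) (hH : 1 ≤ H)
    (φ : EuclideanSpace ℝ (Fin m) → ℝ) (hφC2 : ContDiff ℝ 2 φ) (hφpos : ∀ x, 0 < φ x)
    (hφ : ∀ x, lap φ x + H * a x * φ x ≤ 0)
    (A σ : ℝ) (hA1 : A ≤ 1) (hAH : A < H - 1)
    (hσ1 : 1 < σ) (hσ2 : σ ≤ 2 * H + 1) (hσ3 : σ < 2 * H - A)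
    (hvol : (m : ℝ) ≤ 2 + (2 - μ) * (2 * H) / (σ - 1))
    (u : EuclideanSpace ℝ (Fin m) → ℝ) (huC2 : ContDiff ℝ 2 u) (hunn : ∀ x, 0 ≤ u x)
    (hineq : ∀ x, -A * ‖gradient u x‖ ^ 2
        ≤ u x * lap u x + a x * u x ^ 2 - b x * u x ^ (σ + 1)) :
    ∀ x, u x = 0 := by
  obtain ⟨r₀, hr₀⟩ := hblow
  obtain ⟨M, hM0, hM⟩ := aux_trans
  set β : ℝ := 2 * H / (σ - 1) with hβ
  have hσ' : 0 < σ - 1 := by linarith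
  have hβ0 : 0 < β := by rw [hβ]; positivity
  have hH0 : 0 < H := by linarith
  set n : ℕ := ⌈2 * β⌉₊ with hn
  have hnβ : 2 * β ≤ n := Nat.le_ceil _
  set c : ℝ := ((n : ℝ) + 2) ^ 2 / (4 * H) with hc
  have hc0 : 0 ≤ c := by positivity
  set K : ℝ := c * (4 * M ^ 2) * (2 * c * (4 * M ^ 2) / C) ^ β with hK
  have hK0 : 0 ≤ K := by positivity
  set P : EuclideanSpace ℝ (Fin m) → ℝ := fun x => b x * u x ^ (σ - 1 + 2 * H) with hP
  have hP0 : ∀ x, 0 ≤ P x := fun x => mul_nonneg (hbpos x).le (Real.rpow_nonneg (hunn x) _)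
  have hPc : Continuous P :=
    hb.mul (huC2.continuous.rpow_const fun x => Or.inr (by linarith))
  -- pointwise bound for the divergence
  have hdiv : ∀ L : ℝ, 1 ≤ L → r₀ ^ 2 ≤ L → ∀ x : EuclideanSpace ℝ (Fin m),
      1 / 2 * (auxCut L x ^ (n + 2) * P x) - K / L ^ 2 * auxRad m (Real.exp L) ‖x‖ ≤
        ∑ i, fderiv ℝ (auxF n H (auxCut L) u φ i) x (EuclideanSpace.single i 1) := by
    intro L hL1 hLr x
    set z := auxCut L x with hz
    have hz0 : 0 ≤ z := Real.smoothTransition.nonneg _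
    have hz1 : z ≤ 1 := Real.smoothTransition.le_one _
    set T := ∑ i, (fderiv ℝ (auxCut L) x (EuclideanSpace.single i 1)) ^ 2 with hT
    have hT0 : 0 ≤ T := Finset.sum_nonneg fun i _ => sq_nonneg _
    set q := u x ^ (2 * H - 2) with hq
    have hq0 : 0 ≤ q := Real.rpow_nonneg (hunn x) _
    have q1 : u x ^ (2 * H - 1) = q * u x := by
      rw [hq, ← Real.rpow_add_one' (hunn x) (by linarith)]; ring_nf
    have q2 : u x ^ (2 * H) = q * u x ^ 2 := by
      rw [pow_two, ← mul_assoc, ← q1, ← Real.rpow_add_one' (hunn x) (by linarith)]; ring_nf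
    have q3 : u x ^ (σ - 1 + 2 * H) = q * u x ^ (σ + 1) := by
      rw [hq, ← Real.rpow_add_of_nonneg (hunn x) (by linarith) (by linarith)]; ring_nf
    -- lower bound
    have hlow : z ^ (n + 2) * P x - c * z ^ n * u x ^ (2 * H) * T ≤
        ∑ i, fderiv ℝ (auxF n H (auxCut L) u φ i) x (EuclideanSpace.single i 1) := by
      have hterm : ∀ i ∈ (Finset.univ : Finset (Fin m)),
          z ^ (n + 2) * q * ((H - 1) * (fderiv ℝ u x (EuclideanSpace.single i 1)) ^ 2
            + u x * fderiv ℝ (fun y => fderiv ℝ u y (EuclideanSpace.single i 1)) x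
              (EuclideanSpace.single i 1)
            - u x ^ 2 * (fderiv ℝ (fun y => fderiv ℝ φ y (EuclideanSpace.single i 1)) x
              (EuclideanSpace.single i 1) / (H * φ x)))
          - ((n : ℝ) + 2) ^ 2 / (4 * H) * z ^ n * (q * u x ^ 2)
            * (fderiv ℝ (auxCut L) x (EuclideanSpace.single i 1)) ^ 2 ≤
          fderiv ℝ (auxF n H (auxCut L) u φ i) x (EuclideanSpace.single i 1) := fun i _ => by
        rw [auxF_fderiv n hH (auxCut_contDiff L) huC2 hφC2 hφpos hunn i x _ rfl]
        exact aux_div_term (N := (n : ℝ) + 2) hH0 hq0 hz0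
      refine le_trans ?_ (Finset.sum_le_sum hterm)
      rw [Finset.sum_sub_distrib, ← Finset.mul_sum, ← Finset.mul_sum, Finset.sum_sub_distrib,
        Finset.sum_add_distrib, ← Finset.mul_sum, ← Finset.mul_sum, ← Finset.mul_sum,
        ← Finset.sum_div, ← aux_norm_grad u x, ← hT, ← q2, ← hc]
      have h1 := hineq x
      have h2 : lap φ x / (H * φ x) ≤ - a x := by
        rw [div_le_iff₀ (mul_pos hH0 (hφpos x))]
        linarith [hφ x]
      have h3 := mul_le_mul_of_nonneg_left h2 (sq_nonneg (u x))
      have h4 : 0 ≤ (H - 1 - A) * ‖gradient u x‖ ^ 2 := mul_nonneg (by linarith) (sq_nonneg _)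
      have h5 : b x * u x ^ (σ + 1) ≤ (H - 1) * ‖gradient u x‖ ^ 2 + u x * lap u x
          - u x ^ 2 * (lap φ x / (H * φ x)) := by linarith
      have h6 := mul_le_mul_of_nonneg_left h5 (show 0 ≤ z ^ (n + 2) * q by positivity)
      have h7 : z ^ (n + 2) * P x = z ^ (n + 2) * q * (b x * u x ^ (σ + 1)) := by
        simp only [hP]; rw [q3]; ring
      rw [h7]
      unfold lap at h6
      linarith
    have hy := aux_young (z := z) (v := u x) (b := b x) (T := T) (c := c) (β := β) n hz0 hz1
      (hunn x) (hbpos x) hT0 hc0 hσ1 hH hβ hnβ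
    have hdec : c * T * (2 * c * T / b x) ^ β ≤ K / L ^ 2 * auxRad m (Real.exp L) ‖x‖ := by
      rcases auxCut_grad M hM hL1 x with h | ⟨h1, h2, h3⟩
      · rw [← hT] at h
        rw [h]
        simp only [mul_zero, zero_mul]
        refine mul_nonneg (by positivity) (indicator_nonneg (fun r hr => ?_) _)
        have : (0:ℝ) ≤ r := le_trans zero_le_one hr.1
        positivity
      · have hx1 : 1 ≤ ‖x‖ := by nlinarith [norm_nonneg x]
        have hxr : r₀ ≤ ‖x‖ := by nlinarith [norm_nonneg x, hLr.trans h1]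
        rw [auxRad, indicator_of_mem (show ‖x‖ ∈ Icc 1 (Real.exp L) from ⟨hx1, h2⟩)]
        refine aux_decay hc0 hT0 hC hx1 hL1 hβ0.le h3 (hr₀ x hxr) ?_
        rw [hβ, ← mul_div_assoc]; exact hvol
    have : z ^ (n + 2) * P x = z ^ (n + 2) * (b x * u x ^ (σ - 1 + 2 * H)) := rfl
    linarith
  -- integrated inequality
  set V : ℝ := m * (volume.real (ball (0 : EuclideanSpace ℝ (Fin m)) 1)) with hV
  have hcutP : ∀ L : ℝ, 0 < L → Continuous (fun x => auxCut L x ^ (n + 2) * P x) ∧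
      HasCompactSupport (fun x => auxCut L x ^ (n + 2) * P x) := by
    intro L hL
    refine ⟨((auxCut_contDiff L).continuous.pow _).mul hPc, ?_⟩
    refine (auxCut_supp (m := m) hL).mono fun x hx => ?_
    simp only [Function.mem_support] at hx ⊢
    intro h; apply hx; simp [h]
  have hint : ∀ L : ℝ, 1 ≤ L → r₀ ^ 2 ≤ L →
      ∫ x, auxCut L x ^ (n + 2) * P x ≤ 2 * K * V / L := by
    intro L hL1 hLr
    have hL0 : 0 < L := by linarith
    have hF : ∀ i : Fin m, Integrable (fun x => fderiv ℝ (auxF n H (auxCut L) u φ i) x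
        (EuclideanSpace.single i 1)) ∧ ∫ x, fderiv ℝ (auxF n H (auxCut L) u φ i) x
        (EuclideanSpace.single i 1) = 0 := by
      intro i
      refine aux_int_zero _ (auxF_contDiff n hH (auxCut_contDiff L) huC2 hφC2 hφpos i) ?_ _
      refine (auxCut_supp (m := m) hL0).mono fun x hx => ?_
      simp only [Function.mem_support] at hx ⊢
      intro h; apply hx; simp [auxF, h]
    obtain ⟨hR1, hR2⟩ := auxRad_int hm (R := Real.exp L) (Real.one_le_exp hL0.le)
    have hI := (hcutP L hL0).1.integrable_of_hasCompactSupport (μ := volume) (hcutP L hL0).2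
    have hmono := integral_mono ((hI.const_mul (1 / 2)).sub (hR1.const_mul (K / L ^ 2)))
      (integrable_finsetSum Finset.univ fun i _ => (hF i).1) (fun x => hdiv L hL1 hLr x)
    rw [integral_finsetSum Finset.univ fun i _ => (hF i).1,
      Finset.sum_eq_zero fun i _ => (hF i).2] at hmono
    simp only [Pi.sub_apply] at hmono
    rw [integral_sub (hI.const_mul (1 / 2)) (hR1.const_mul (K / L ^ 2)), integral_const_mul,
      integral_const_mul, hR2, Real.log_exp] at hmono
    have : K / L ^ 2 * (V * L) = K * V / L := by field_simp
    rw [this] at hmono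
    have h2 : 2 * K * V / L = 2 * (K * V / L) := by ring
    rw [h2]; linarith
  intro x₀
  by_contra hne
  have hupos : 0 < u x₀ := lt_of_le_of_ne (hunn x₀) (Ne.symm hne)
  have hPpos : 0 < P x₀ := mul_pos (hbpos x₀) (Real.rpow_pos_of_pos hupos _)
  set L₀ : ℝ := 1 + Real.log (1 + ‖x₀‖ ^ 2) with hL₀
  have hlog : 0 ≤ Real.log (1 + ‖x₀‖ ^ 2) := Real.log_nonneg (by nlinarith [sq_nonneg ‖x₀‖])
  have hL₀1 : 0 < L₀ := by linarith
  have hIpos : 0 < ∫ x, auxCut L₀ x ^ (n + 2) * P x := by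
    refine (hcutP L₀ hL₀1).1.integral_pos_of_hasCompactSupport_nonneg_nonzero (x := x₀)
      (hcutP L₀ hL₀1).2 (fun x => ?_) ?_
    · exact mul_nonneg (pow_nonneg (Real.smoothTransition.nonneg _) _) (hP0 x)
    · rw [auxCut_one hL₀1 x₀ (by linarith)]; simpa using hPpos.ne'
  set I := ∫ x, auxCut L₀ x ^ (n + 2) * P x with hI
  have hlim : Tendsto (fun L : ℝ => 2 * K * V / L) atTop (nhds 0) :=
    tendsto_const_nhds.div_atTop tendsto_id
  obtain ⟨L, hL1, hL2, hL3, hL4⟩ := ((hlim.eventually (gt_mem_nhds hIpos)).and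
    ((eventually_ge_atTop (1 : ℝ)).and ((eventually_ge_atTop (r₀ ^ 2)).and
      (eventually_ge_atTop (2 * L₀))))).exists
  have hle : I ≤ ∫ x, auxCut L x ^ (n + 2) * P x := by
    have hL0 : 0 < L := by linarith
    refine integral_mono
      ((hcutP L₀ hL₀1).1.integrable_of_hasCompactSupport (μ := volume) (hcutP L₀ hL₀1).2)
      ((hcutP L hL0).1.integrable_of_hasCompactSupport (μ := volume) (hcutP L hL0).2) fun x => ?_
    refine mul_le_mul_of_nonneg_right ?_ (hP0 x)
    refine pow_le_pow_left₀ (Real.smoothTransition.nonneg _) ?_ _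
    change auxCut L₀ x ≤ auxCut L x
    rcases le_total (2 * L₀) (Real.log (1 + ‖x‖ ^ 2)) with h | h
    · rw [auxCut_zero hL₀1 x h]; exact Real.smoothTransition.nonneg _
    · rw [auxCut_one hL0 x (h.trans hL4)]; exact Real.smoothTransition.le_one _
  have := hint L hL2 hL3
  linarith
end
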